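/- arXiv:1605.08937 — 8 statements merged into one kernel-verified Lean document; each statement's English description precedes it below -/
import Mathlib

section
/- (Well-definedness part of the lemma on the map 𝕂/𝕃 → Box(Σ).) For every l ∈ 𝕂 the element v(l) = Σ_{i=1}^n ⌈l_i⌉ a_i lies in Box(Σ); more precisely, v(l) = Σ_{i=1}^n {−l_i} a_i, where {·} denotes the fractional part, and v(l) ∈ Box(σ) for σ := {i ∈ {1,…,m} : l_i ∉ ℤ} ∈ Σ. -/
open Finset

/-- The (rational) cone spanned by the vectors `A i`, `i ∈ σ`. -/
def coneQ {d : ℕ} (A : ℕ → (Fin d → ℚ)) (σ : Finset ℕ) : Set (Fin d → ℚ) :=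
  {x | ∃ r : ℕ → ℚ, (∀ i, 0 ≤ r i) ∧ x = ∑ i ∈ σ, r i • A i}

/-- A complete simplicial fan on `A 0, …, A (m-1)`: a nonempty finite collection of
subsets of `{0,…,m-1}`, closed under taking subsets, satisfying the axioms
(i) (linear independence), (ii) (completeness) and (iii) (intersection). -/
def IsFanQ {d : ℕ} (A : ℕ → (Fin d → ℚ)) (m : ℕ) (S : Finset (Finset ℕ)) : Prop :=
  S.Nonempty ∧
  (∀ σ ∈ S, ∀ i ∈ σ, i < m) ∧
  (∀ σ ∈ S, ∀ τ ⊆ σ, τ ∈ S) ∧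
  (∀ σ ∈ S, LinearIndependent ℚ (fun i : ↥σ => A i.1)) ∧
  (∀ x : Fin d → ℚ, ∃ σ ∈ S, x ∈ coneQ A σ) ∧
  (∀ σ ∈ S, ∀ σ' ∈ S, ∃ τ ∈ S, τ ⊆ σ ∩ σ' ∧ coneQ A σ ∩ coneQ A σ' = coneQ A τ)

/-- `φ` is linear on each cone of the fan `S`. -/
def PwLinQ {d : ℕ} (A : ℕ → (Fin d → ℚ)) (S : Finset (Finset ℕ)) (φ : (Fin d → ℚ) → ℚ) : Prop :=
  ∀ σ ∈ S, ∃ L : (Fin d → ℚ) →ₗ[ℚ] ℚ, ∀ x ∈ coneQ A σ, φ x = L x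

/-- `φ ∈ PL(Σ)`: integer valued on the lattice and linear on each cone of the fan. -/
def IsPLQ {d : ℕ} (A : ℕ → (Fin d → ℚ)) (S : Finset (Finset ℕ)) (φ : (Fin d → ℚ) → ℚ) : Prop :=
  (∀ x : Fin d → ℤ, ∃ k : ℤ, φ (fun j => (x j : ℚ)) = (k : ℚ)) ∧ PwLinQ A S φ

/-- Convexity for functions `ℚ^d → ℚ`. -/
def ConvexFnQ {d : ℕ} (φ : (Fin d → ℚ) → ℚ) : Prop :=
  ∀ x y : Fin d → ℚ, ∀ t : ℚ, 0 ≤ t → t ≤ 1 →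
    φ (t • x + (1 - t) • y) ≤ t * φ x + (1 - t) * φ y

/-- `c ∈ Box(σ)`: `c = ∑_{i ∈ σ} r i • A i` with `0 ≤ r i < 1`. -/
def InBoxQ {d : ℕ} (A : ℕ → (Fin d → ℚ)) (σ : Finset ℕ) (c : Fin d → ℤ) : Prop :=
  ∃ r : ℕ → ℚ, (∀ i ∈ σ, 0 ≤ r i ∧ r i < 1) ∧
    (fun j => (c j : ℚ)) = ∑ i ∈ σ, r i • A i

open Classical in
/-- The set `{i ∈ {0,…,m-1} : l i ∉ ℤ}`. -/
noncomputable def fracSupp (m : ℕ) (l : ℕ → ℚ) : Finset ℕ :=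
  (Finset.range m).filter (fun i => ¬ ∃ z : ℤ, l i = (z : ℚ))

/-- `l ∈ 𝕂`: `∑ l i • A i = 0`, the extended coordinates `l (m+k)` are integers, and
the set of indices `i < m` with `l i ∉ ℤ` is a cone of the fan. -/
def InK {d : ℕ} (A : ℕ → (Fin d → ℚ)) (m e : ℕ) (S : Finset (Finset ℕ)) (l : ℕ → ℚ) : Prop :=
  (∑ i ∈ Finset.range (m + e), l i • A i = 0) ∧
  (∀ k < e, ∃ z : ℤ, l (m + k) = (z : ℚ)) ∧
  fracSupp m l ∈ S

/-- `v(l) = ∑_{i=1}^{n} ⌈l i⌉ • a i ∈ ℤ^d`. -/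
def vK {d : ℕ} (a : ℕ → (Fin d → ℤ)) (m e : ℕ) (l : ℕ → ℚ) : Fin d → ℤ :=
  ∑ i ∈ Finset.range (m + e), ⌈l i⌉ • a i

/-- (Well-definedness of the map `𝕂/𝕃 → Box(Σ)`.) For `l ∈ 𝕂`,
`v(l) = ∑ ⌈l i⌉ a i` equals `∑ {−l i} a i` (fractional parts), and
`v(l) ∈ Box(σ)` for `σ := {i < m : l i ∉ ℤ} ∈ Σ`. -/
theorem vK_mem_Box (d m e : ℕ) (hd : 1 ≤ d) (hm : 1 ≤ m)
    (a : ℕ → (Fin d → ℤ)) (A : ℕ → (Fin d → ℚ)) (hA : ∀ i j, A i j = (a i j : ℚ))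
    (S : Finset (Finset ℕ)) (hfan : IsFanQ A m S)
    (hmax : ∀ σ ∈ S, ∃ σ' ∈ S, σ ⊆ σ' ∧ σ'.card = d)
    (l : ℕ → ℚ) (hl : InK A m e S l) :
    (fun j => ((vK a m e l) j : ℚ)) =
      (∑ i ∈ Finset.range (m + e), Int.fract (-(l i)) • A i) ∧
    InBoxQ A (fracSupp m l) (vK a m e l) := by
  obtain ⟨h0, hint, -⟩ := hl
  have key : (fun j => ((vK a m e l) j : ℚ)) =
      (∑ i ∈ Finset.range (m + e), Int.fract (-(l i)) • A i) := by
    have h1 : (fun j => ((vK a m e l) j : ℚ)) =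
        ∑ i ∈ Finset.range (m + e), (⌈l i⌉ : ℚ) • A i := by
      funext j
      simp [vK, Finset.sum_apply, hA]
    rw [h1, ← sub_zero (∑ i ∈ Finset.range (m + e), (⌈l i⌉ : ℚ) • A i), ← h0,
      ← Finset.sum_sub_distrib]
    refine Finset.sum_congr rfl fun i _ => ?_
    rw [← sub_smul, Int.fract, Int.floor_neg]
    congr 1
    push_cast
    ring
  refine ⟨key, fun i => Int.fract (-(l i)),
    fun i _ => ⟨Int.fract_nonneg _, Int.fract_lt_one _⟩, ?_⟩
  rw [key]
  symm
  apply Finset.sum_subset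
  · intro i hi
    simp only [fracSupp, Finset.mem_filter, Finset.mem_range] at hi ⊢
    omega
  · intro i hi hn
    have hz : ∃ z : ℤ, l i = (z : ℚ) := by
      by_cases him : i < m
      · by_contra hc
        exact hn (by
          simp only [fracSupp, Finset.mem_filter, Finset.mem_range]
          exact ⟨him, hc⟩)
      · have hi' := Finset.mem_range.mp hi
        obtain ⟨z, hz⟩ := hint (i - m) (by omega)
        exact ⟨z, by rw [← hz]; congr 1; omega⟩
    obtain ⟨z, hz⟩ := hz
    have : Int.fract (-(l i)) = 0 := by
      rw [hz, ← Int.cast_neg, Int.fract_intCast]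
    simp [this]
end

section
/- (Injectivity part of the lemma on the map 𝕂/𝕃 → Box(Σ).) If l, l' ∈ 𝕂 satisfy v(l) = v(l'), then l − l' ∈ 𝕃; equivalently, l_i − l'_i ∈ ℤ for every i = 1, …, n. -/
open Finset

theorem coeff_eq_of_indep {d : ℕ} (A : ℕ → (Fin d → ℚ)) (σ τ : Finset ℕ) (hτ : τ ⊆ σ)
    (hind : LinearIndependent ℚ (fun i : ↥σ => A i.1)) (r t : ℕ → ℚ)
    (h : ∑ i ∈ σ, r i • A i = ∑ i ∈ τ, t i • A i) :
    ∀ i ∈ σ, r i = if i ∈ τ then t i else 0 := by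
  have h1 : ∑ i ∈ τ, t i • A i = ∑ i ∈ σ, (if i ∈ τ then t i else 0) • A i := by
    rw [← Finset.sum_subset hτ (f := fun i => (if i ∈ τ then t i else 0) • A i)]
    · exact Finset.sum_congr rfl (fun i hi => by simp [hi])
    · intro i _ hi
      simp [hi]
  have h2 : ∑ i ∈ σ, (r i - if i ∈ τ then t i else 0) • A i = 0 := by
    simp only [sub_smul, Finset.sum_sub_distrib]
    rw [h, h1, sub_self]
  rw [← Finset.sum_coe_sort] at h2
  intro i hi
  have h3 := Fintype.linearIndependent_iff.mp hind
    (fun i : ↥σ => r i.1 - if i.1 ∈ τ then t i.1 else 0) h2 ⟨i, hi⟩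
  exact sub_eq_zero.mp h3

theorem vK_rep {d : ℕ} (m e : ℕ) (a : ℕ → (Fin d → ℤ)) (A : ℕ → (Fin d → ℚ))
    (hA : ∀ i j, A i j = (a i j : ℚ)) (S : Finset (Finset ℕ)) (l : ℕ → ℚ)
    (hl : InK A m e S l) :
    (∀ i < m + e, i ∉ fracSupp m l → (⌈l i⌉ : ℚ) - l i = 0) ∧
    (fun j => (vK a m e l j : ℚ)) = ∑ i ∈ fracSupp m l, ((⌈l i⌉ : ℚ) - l i) • A i := by
  obtain ⟨h0, hint, -⟩ := hl
  have hz : ∀ i < m + e, i ∉ fracSupp m l → (⌈l i⌉ : ℚ) - l i = 0 := by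
    intro i hi hn
    have : ∃ z : ℤ, l i = (z : ℚ) := by
      by_cases him : i < m
      · by_contra hc
        exact hn (by simp only [fracSupp, Finset.mem_filter, Finset.mem_range]; exact ⟨him, hc⟩)
      · obtain ⟨z, hz⟩ := hint (i - m) (by omega)
        rw [show m + (i - m) = i by omega] at hz
        exact ⟨z, hz⟩
    obtain ⟨z, hz⟩ := this
    simp [hz]
  refine ⟨hz, ?_⟩
  have hsub : fracSupp m l ⊆ Finset.range (m + e) := by
    intro i hi
    simp only [fracSupp, Finset.mem_filter, Finset.mem_range] at hi ⊢
    omega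
  rw [Finset.sum_subset hsub (fun i hi hn => by
    rw [hz i (Finset.mem_range.mp hi) hn, zero_smul])]
  simp only [sub_smul, Finset.sum_sub_distrib]
  rw [h0, sub_zero]
  funext j
  simp [vK, Finset.sum_apply, hA]

/-- (Injectivity of the map `𝕂/𝕃 → Box(Σ)`.) If `l, l' ∈ 𝕂` and
`v(l) = v(l')`, then `l − l' ∈ 𝕃`; equivalently, `l i − l' i ∈ ℤ` for all `i < n`. -/
theorem vK_injective (d m e : ℕ) (hd : 1 ≤ d) (hm : 1 ≤ m)
    (a : ℕ → (Fin d → ℤ)) (A : ℕ → (Fin d → ℚ)) (hA : ∀ i j, A i j = (a i j : ℚ))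
    (S : Finset (Finset ℕ)) (hfan : IsFanQ A m S)
    (hmax : ∀ σ ∈ S, ∃ σ' ∈ S, σ ⊆ σ' ∧ σ'.card = d)
    (l l' : ℕ → ℚ) (hl : InK A m e S l) (hl' : InK A m e S l')
    (h : vK a m e l = vK a m e l') :
    ∀ i < m + e, ∃ z : ℤ, l i - l' i = (z : ℚ) := by
  obtain ⟨-, -, -, hind, -, hint⟩ := hfan
  obtain ⟨hz, hv⟩ := vK_rep m e a A hA S l hl
  obtain ⟨hz', hv'⟩ := vK_rep m e a A hA S l' hl'
  obtain ⟨τ, -, hτ, hcone⟩ := hint _ hl.2.2 _ hl'.2.2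
  have hx : (fun j => (vK a m e l j : ℚ)) ∈ coneQ A τ := by
    rw [← hcone]
    refine ⟨⟨fun i => (⌈l i⌉ : ℚ) - l i, fun i => sub_nonneg.mpr (Int.le_ceil _), hv⟩,
      ⟨fun i => (⌈l' i⌉ : ℚ) - l' i, fun i => sub_nonneg.mpr (Int.le_ceil _), ?_⟩⟩
    rw [h]
    exact hv'
  obtain ⟨t, -, ht⟩ := hx
  have h1 := coeff_eq_of_indep A _ τ (hτ.trans Finset.inter_subset_left) (hind _ hl.2.2)
    (fun i => (⌈l i⌉ : ℚ) - l i) t (hv.symm.trans ht)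
  rw [h] at ht
  have h2 := coeff_eq_of_indep A _ τ (hτ.trans Finset.inter_subset_right) (hind _ hl'.2.2)
    (fun i => (⌈l' i⌉ : ℚ) - l' i) t (hv'.symm.trans ht)
  intro i hi
  have e1 : (⌈l i⌉ : ℚ) - l i = if i ∈ τ then t i else 0 := by
    by_cases hs : i ∈ fracSupp m l
    · exact h1 i hs
    · rw [hz i hi hs, if_neg (fun hc => hs (Finset.mem_inter.mp (hτ hc)).1)]
  have e2 : (⌈l' i⌉ : ℚ) - l' i = if i ∈ τ then t i else 0 := by
    by_cases hs : i ∈ fracSupp m l'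
    · exact h2 i hs
    · rw [hz' i hi hs, if_neg (fun hc => hs (Finset.mem_inter.mp (hτ hc)).2)]
  refine ⟨⌈l i⌉ - ⌈l' i⌉, ?_⟩
  push_cast
  linarith
end

section
/- (Surjectivity part of the lemma on the map 𝕂/𝕃 → Box(Σ).) For every v ∈ Box(Σ) there exists l ∈ 𝕂 with v(l) = v. Together with well-definedness and injectivity this makes the induced map 𝕂/𝕃 → Box(Σ), l ↦ v(l), bijective. -/
open Finset

/-- (Surjectivity of the map `𝕂/𝕃 → Box(Σ)`.) Under the assumption
(corresponding to the choice `S = Gen(Σ)`) that every `v ∈ Box(Σ)` can be written as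
`v = ∑ n_i a_i` with natural numbers `n_i`, supported on indices with `a_i ∈ cone(σ)`
for some cone `σ ∈ Σ`, every `v ∈ Box(Σ)` is of the form `v(l)` for some `l ∈ 𝕂`. -/
theorem vK_surjective (d m e : ℕ) (hd : 1 ≤ d) (hm : 1 ≤ m)
    (a : ℕ → (Fin d → ℤ)) (A : ℕ → (Fin d → ℚ)) (hA : ∀ i j, A i j = (a i j : ℚ))
    (S : Finset (Finset ℕ)) (hfan : IsFanQ A m S)
    (hmax : ∀ σ ∈ S, ∃ σ' ∈ S, σ ⊆ σ' ∧ σ'.card = d)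
    (hgen : ∀ v : Fin d → ℤ, (∃ σ ∈ S, InBoxQ A σ v) →
      ∃ σ ∈ S, ∃ nn : ℕ → ℕ,
        (∀ i < m + e, A i ∉ coneQ A σ → nn i = 0) ∧
        v = ∑ i ∈ Finset.range (m + e), (nn i : ℤ) • a i)
    (v : Fin d → ℤ) (hv : ∃ σ ∈ S, InBoxQ A σ v) :
    ∃ l : ℕ → ℚ, InK A m e S l ∧ vK a m e l = v := by
  obtain ⟨σ, hσ, r, hr, hvr⟩ := hv
  obtain ⟨_, _, nn, _, hvn⟩ := hgen v ⟨σ, hσ, r, hr, hvr⟩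
  obtain ⟨_, hlt, hsub, _⟩ := hfan
  have hσm : ∀ i ∈ σ, i < m := hlt σ hσ
  have hss : σ ⊆ Finset.range (m + e) := fun i hi =>
    Finset.mem_range.2 (lt_of_lt_of_le (hσm i hi) (Nat.le_add_right m e))
  refine ⟨fun i => (nn i : ℚ) - (if i ∈ σ then r i else 0), ⟨?_, ?_, ?_⟩, ?_⟩
  · have h1 : ∑ i ∈ Finset.range (m + e), (if i ∈ σ then r i else 0) • A i
        = ∑ i ∈ σ, r i • A i := by
      rw [← Finset.sum_subset hss]
      · exact Finset.sum_congr rfl (fun i hi => by rw [if_pos hi])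
      · intro i _ hi
        rw [if_neg hi, zero_smul]
    simp only [sub_smul]
    rw [Finset.sum_sub_distrib, h1, ← hvr, sub_eq_zero]
    funext j
    rw [hvn]
    simp [Finset.sum_apply, hA]
  · intro k _
    have hk : m + k ∉ σ := fun h => by
      have := hσm _ h
      omega
    exact ⟨nn (m + k), by simp [hk]⟩
  · apply hsub σ hσ
    intro i hi
    by_contra h
    classical
    simp only [fracSupp, Finset.mem_filter] at hi
    exact hi.2 ⟨nn i, by simp [h]⟩
  · rw [hvn]
    unfold vK
    apply Finset.sum_congr rfl
    intro i _
    congr 1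
    rw [Int.ceil_eq_iff]
    by_cases h : i ∈ σ
    · have := hr i h
      simp only [h, if_true, Int.cast_natCast]
      constructor <;> linarith
    · simp [h]
end

section
/- (Lemma: 𝕃 ⊂ 𝕂 ⊂ NE^e(X).) One has 𝕃 ⊆ 𝕂, and every element of 𝕂 pairs integrally with the extended Picard group: for every l ∈ 𝕂 and every φ ∈ PL(Σ), Σ_{i=1}^n φ(a_i) l_i ∈ ℤ (note that l_{m+k} ∈ ℤ for k = 1,…,e holds by definition of 𝕂, so l lies in the dual lattice NE^e(X) of the extended Picard group Pic^e(X), which is generated by Θ(PL(Σ)) and the coordinate functionals D_{m+1}, …, D_n). -/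
open Finset

/-- (Lemma: `𝕃 ⊆ 𝕂 ⊆ NE^e(X)`.) Every integral relation among the
`a_i` lies in `𝕂`, and every element of `𝕂` pairs integrally with the extended
Picard group: for every `l ∈ 𝕂` and every `φ ∈ PL(Σ)`, `∑ i, φ (a i) * l i ∈ ℤ`
(the extended coordinates `l (m+k)` being integral by definition of `𝕂`). -/
theorem L_subset_K_subset_NE (d m e : ℕ) (hd : 1 ≤ d) (hm : 1 ≤ m)
    (a : ℕ → (Fin d → ℤ)) (A : ℕ → (Fin d → ℚ)) (hA : ∀ i j, A i j = (a i j : ℚ))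
    (S : Finset (Finset ℕ)) (hfan : IsFanQ A m S)
    (hmax : ∀ σ ∈ S, ∃ σ' ∈ S, σ ⊆ σ' ∧ σ'.card = d) :
    (∀ w : ℕ → ℤ, (∑ i ∈ Finset.range (m + e), w i • a i = 0) →
      InK A m e S (fun i => (w i : ℚ))) ∧
    (∀ l : ℕ → ℚ, InK A m e S l → ∀ φ : (Fin d → ℚ) → ℚ, IsPLQ A S φ →
      ∃ z : ℤ, ∑ i ∈ Finset.range (m + e), φ (A i) * l i = (z : ℚ)) := by
  obtain ⟨hne, -, hsub, -, -, -⟩ := hfan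
  refine ⟨?_, ?_⟩
  · intro w hw
    refine ⟨?_, fun k _ => ⟨_, rfl⟩, ?_⟩
    · funext j
      have h := congrFun hw j
      simp only [Finset.sum_apply, Pi.smul_apply, smul_eq_mul, Pi.zero_apply, hA] at h ⊢
      exact_mod_cast h
    · obtain ⟨σ, hσ⟩ := hne
      have : fracSupp m (fun i => (w i : ℚ)) = ∅ := by
        simp [fracSupp]
      rw [this]
      exact hsub σ hσ ∅ (Finset.empty_subset _)
  · intro l hl φ hφ
    obtain ⟨h0, hint, hS⟩ := hl
    obtain ⟨hZ, hlin⟩ := hφ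
    obtain ⟨L, hL⟩ := hlin _ hS
    have hsubr : fracSupp m l ⊆ Finset.range (m + e) := by
      intro i hi
      simp only [fracSupp, Finset.mem_filter, Finset.mem_range] at hi ⊢
      omega
    have hceil : ∀ i ∈ Finset.range (m + e), i ∉ fracSupp m l → (⌈l i⌉ : ℚ) - l i = 0 := by
      intro i hi hn
      have : ∃ z : ℤ, l i = (z : ℚ) := by
        by_cases him : i < m
        · by_contra hc
          exact hn (by simp only [fracSupp, Finset.mem_filter, Finset.mem_range]; exact ⟨him, hc⟩)
        · have := Finset.mem_range.1 hi
          have h := hint (i - m) (by omega)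
          rwa [Nat.add_sub_cancel' (by omega)] at h
      obtain ⟨z, hz⟩ := this
      rw [hz]; simp
    have hcone : ∀ i ∈ fracSupp m l, φ (A i) = L (A i) := by
      intro i hi
      apply hL
      refine ⟨fun j => if j = i then 1 else 0, fun j => by dsimp only; split_ifs <;> norm_num, ?_⟩
      simp [ite_smul, hi]
    have hx : (fun j => ((vK a m e l) j : ℚ))
        = ∑ i ∈ fracSupp m l, ((⌈l i⌉ : ℚ) - l i) • A i := by
      rw [Finset.sum_subset hsubr (fun i hi hn => by rw [hceil i hi hn, zero_smul])]
      simp only [sub_smul, Finset.sum_sub_distrib, h0, sub_zero]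
      funext j
      simp [vK, Finset.sum_apply, hA]
    have hφx : φ (fun j => ((vK a m e l) j : ℚ))
        = ∑ i ∈ Finset.range (m + e), ((⌈l i⌉ : ℚ) - l i) * φ (A i) := by
      rw [hL _ ⟨fun i => (⌈l i⌉ : ℚ) - l i, fun i => sub_nonneg.2 (Int.le_ceil _), hx⟩, hx,
        ← Finset.sum_subset hsubr (fun i hi hn => by rw [hceil i hi hn, zero_mul]), map_sum]
      refine Finset.sum_congr rfl fun i hi => ?_
      rw [map_smul, smul_eq_mul, hcone i hi]
    have hAi : ∀ i, ∃ k : ℤ, φ (A i) = (k : ℚ) := by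
      intro i
      have : A i = fun j => (a i j : ℚ) := funext (hA i)
      rw [this]; exact hZ _
    choose k hk using hAi
    obtain ⟨c, hc⟩ := hZ (vK a m e l)
    refine ⟨∑ i ∈ Finset.range (m + e), ⌈l i⌉ * k i - c, ?_⟩
    push_cast
    rw [← hc, hφx, ← Finset.sum_sub_distrib]
    refine Finset.sum_congr rfl fun i _ => ?_
    rw [hk i]; ring
end

section
/- (Lemma 2.6, characterization of ρ ∈ 𝒦^e.) Let 𝕃_ℚ := {l ∈ ℚ^n : Σ_{i=1}^n l_i a_i = 0}. Define linear functionals on 𝕃_ℚ: ρ(l) := Σ_{i=1}^n l_i; for φ ∈ PL(Σ), Θ̂(φ)(l) := Σ_{i=1}^n φ(a_i) l_i; and D̂_{m+k}(l) := l_{m+k} for k = 1,…,e. Let φ₀ : ℚ^d → ℚ be a function that is linear on each cone of Σ (for every σ ∈ Σ there is a ℚ-linear map agreeing with φ₀ on cone(σ)) and satisfies φ₀(a_i) = 1 for i = 1,…,m. Then the following are equivalent: (a) there exist finitely many φ_1,…,φ_p ∈ CPL(Σ) and rational numbers c_1,…,c_p ≥ 0, μ_1,…,μ_e ≥ 0 such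 that ρ = Σ_j c_j Θ̂(φ_j) + Σ_k μ_k D̂_{m+k} as functionals on 𝕃_ℚ (i.e. ρ lies in the extended Kähler cone 𝒦^e); (b) φ₀ is convex and φ₀(a_{m+k}) ≤ 1 for all k = 1,…,e (i.e. the underlying toric variety is nef and deg(a_{m+k}) ≤ 1). -/
open Finset

theorem mem_coneQ_ray {d : ℕ} (A : ℕ → (Fin d → ℚ)) (σ : Finset ℕ) (i : ℕ) (hi : i ∈ σ) :
    A i ∈ coneQ A σ := by
  refine ⟨fun j => if j = i then 1 else 0, fun j => ?_, ?_⟩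
  · dsimp only
    split_ifs <;> norm_num
  · simp [ite_smul, hi]

theorem PwLinQ.eq_sum {d : ℕ} {A : ℕ → (Fin d → ℚ)} {S : Finset (Finset ℕ)}
    {φ : (Fin d → ℚ) → ℚ} (h : PwLinQ A S φ) {σ : Finset ℕ} (hσ : σ ∈ S)
    (r : ℕ → ℚ) (hr : ∀ i, 0 ≤ r i) :
    φ (∑ i ∈ σ, r i • A i) = ∑ i ∈ σ, r i * φ (A i) := by
  obtain ⟨L, hL⟩ := h σ hσ
  rw [hL _ ⟨r, hr, rfl⟩, map_sum]
  refine Finset.sum_congr rfl fun i hi => ?_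
  rw [hL _ (mem_coneQ_ray A σ i hi), map_smul, smul_eq_mul]

theorem exists_linear_of_relations {d : ℕ} (A : ℕ → (Fin d → ℚ)) (n : ℕ) (w : ℕ → ℚ)
    (h : ∀ l : ℕ → ℚ, (∑ i ∈ Finset.range n, l i • A i = 0) →
      ∑ i ∈ Finset.range n, w i * l i = 0) :
    ∃ M : (Fin d → ℚ) →ₗ[ℚ] ℚ, ∀ i < n, M (A i) = w i := by
  let g : (ℕ → ℚ) →ₗ[ℚ] (Fin d → ℚ) :=
    ∑ i ∈ Finset.range n, (LinearMap.proj i : (ℕ → ℚ) →ₗ[ℚ] ℚ).smulRight (A i)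
  let f : (ℕ → ℚ) →ₗ[ℚ] ℚ :=
    ∑ i ∈ Finset.range n, w i • (LinearMap.proj i : (ℕ → ℚ) →ₗ[ℚ] ℚ)
  have hg : ∀ l, g l = ∑ i ∈ Finset.range n, l i • A i := by
    intro l; simp [g]
  have hf : ∀ l, f l = ∑ i ∈ Finset.range n, w i * l i := by
    intro l; simp [f]
  have hmem : f ∈ LinearMap.range g.dualMap := by
    rw [LinearMap.range_dualMap_eq_dualAnnihilator_ker, Submodule.mem_dualAnnihilator]
    intro l hl
    rw [LinearMap.mem_ker, hg] at hl
    rw [hf]; exact h l hl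
  obtain ⟨M, hM⟩ := hmem
  refine ⟨M, fun i hi => ?_⟩
  have h1 := LinearMap.congr_fun hM (Pi.single i 1)
  rw [LinearMap.dualMap_apply, hf, hg] at h1
  simpa [Pi.single_apply, ite_smul, hi] using h1

theorem exists_common_denom {ι : Type*} (s : Finset ι) (q : ι → ℚ) :
    ∃ N : ℕ, 0 < N ∧ ∀ i ∈ s, ∃ k : ℤ, (N : ℚ) * q i = k := by
  refine ⟨∏ i ∈ s, (q i).den, Finset.prod_pos fun i _ => (q i).pos, fun i hi => ?_⟩
  obtain ⟨c, hc⟩ := Finset.dvd_prod_of_mem (fun i => (q i).den) hi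
  refine ⟨c * (q i).num, ?_⟩
  rw [hc]
  push_cast
  have := Rat.den_mul_eq_num (q i)
  rw [← this]; ring

theorem exists_integral_multiple {d : ℕ} {A : ℕ → (Fin d → ℚ)} {S : Finset (Finset ℕ)}
    {φ : (Fin d → ℚ) → ℚ} (h : PwLinQ A S φ)
    (hc : ∀ x : Fin d → ℚ, ∃ σ ∈ S, x ∈ coneQ A σ) :
    ∃ N : ℕ, 0 < N ∧ ∀ x : Fin d → ℤ, ∃ k : ℤ, (N : ℚ) * φ (fun j => (x j : ℚ)) = k := by
  choose! L hL using h
  obtain ⟨N, hN, hk⟩ := exists_common_denom (S ×ˢ (Finset.univ : Finset (Fin d)))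
    (fun p => L p.1 (Pi.single p.2 1))
  refine ⟨N, hN, fun x => ?_⟩
  obtain ⟨σ, hσ, hx⟩ := hc (fun j => (x j : ℚ))
  have hk' : ∀ j : Fin d, ∃ k : ℤ, (N : ℚ) * L σ (Pi.single j 1) = k := fun j =>
    hk (σ, j) (by simp [hσ])
  choose k hk2 using hk'
  refine ⟨∑ j, x j * k j, ?_⟩
  rw [hL σ hσ _ hx, LinearMap.pi_apply_eq_sum_univ, Finset.mul_sum]
  push_cast
  refine Finset.sum_congr rfl fun j _ => ?_
  rw [← hk2 j, smul_eq_mul]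
  have : (fun i => if j = i then (1 : ℚ) else 0) = Pi.single j 1 := by
    ext i; simp [Pi.single_apply, eq_comm]
  rw [this]; ring

/-- (Lemma 2.6: characterization of `ρ ∈ 𝒦^e`.) The functional
`ρ(l) = ∑ l i` on `𝕃_ℚ = {l : ∑ l i • a i = 0}` is a nonnegative combination of
functionals `Θ̂(φ)` with `φ ∈ CPL(Σ)` and of the coordinate functionals
`D_{m+k}`, if and only if the function `φ₀` (linear on cones, with `φ₀(a_i) = 1`
for `i < m`) is convex and `φ₀(a_{m+k}) ≤ 1` for `k = 1,…,e`. -/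
theorem rho_mem_extended_Kahler_cone_iff (d m e : ℕ) (hd : 1 ≤ d) (hm : 1 ≤ m)
    (a : ℕ → (Fin d → ℤ)) (A : ℕ → (Fin d → ℚ)) (hA : ∀ i j, A i j = (a i j : ℚ))
    (S : Finset (Finset ℕ)) (hfan : IsFanQ A m S)
    (hmax : ∀ σ ∈ S, ∃ σ' ∈ S, σ ⊆ σ' ∧ σ'.card = d)
    (φ₀ : (Fin d → ℚ) → ℚ) (hφ₀lin : PwLinQ A S φ₀)
    (hφ₀val : ∀ i < m, φ₀ (A i) = 1) :
    (∃ p : ℕ, ∃ φs : ℕ → ((Fin d → ℚ) → ℚ), ∃ cs : ℕ → ℚ, ∃ μ : ℕ → ℚ,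
      (∀ j < p, IsPLQ A S (φs j) ∧ ConvexFnQ (φs j)) ∧
      (∀ j < p, 0 ≤ cs j) ∧ (∀ k < e, 0 ≤ μ k) ∧
      (∀ l : ℕ → ℚ, (∑ i ∈ Finset.range (m + e), l i • A i = 0) →
        ∑ i ∈ Finset.range (m + e), l i =
          (∑ j ∈ Finset.range p, cs j * ∑ i ∈ Finset.range (m + e), φs j (A i) * l i) +
          ∑ k ∈ Finset.range e, μ k * l (m + k))) ↔
    (ConvexFnQ φ₀ ∧ ∀ k < e, φ₀ (A (m + k)) ≤ 1) := by
  obtain ⟨-, hlt, -, -, hcomp, -⟩ := hfan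
  constructor
  · rintro ⟨p, φs, cs, μ, hφ, hcs, hμ, hrel⟩
    obtain ⟨M, hM⟩ := exists_linear_of_relations A (m + e)
      (fun i => 1 - ∑ j ∈ Finset.range p, cs j * φs j (A i) -
        (if i < m then 0 else μ (i - m))) (by
      intro l hl
      have h1 := hrel l hl
      have h2 : ∑ i ∈ Finset.range (m + e), (if i < m then 0 else μ (i - m)) * l i =
          ∑ k ∈ Finset.range e, μ k * l (m + k) := by
        rw [Finset.sum_range_add]
        rw [Finset.sum_eq_zero, zero_add]
        · refine Finset.sum_congr rfl fun k _ => ?_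
          simp
        · intro i hi
          simp [Finset.mem_range.1 hi]
      have h3 : ∑ i ∈ Finset.range (m + e), (∑ j ∈ Finset.range p, cs j * φs j (A i)) * l i =
          ∑ j ∈ Finset.range p, cs j * ∑ i ∈ Finset.range (m + e), φs j (A i) * l i := by
        simp only [Finset.sum_mul, Finset.mul_sum]
        rw [Finset.sum_comm]
        simp only [mul_assoc]
      simp only [sub_mul, Finset.sum_sub_distrib, one_mul]
      rw [h2, h3, h1]; ring)
    have key : ∀ x, φ₀ x = ∑ j ∈ Finset.range p, cs j * φs j x + M x := by
      intro x
      obtain ⟨σ, hσ, r, hr, rfl⟩ := hcomp x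
      rw [hφ₀lin.eq_sum hσ r hr, map_sum]
      have h1 : ∀ j ∈ Finset.range p, cs j * φs j (∑ i ∈ σ, r i • A i) =
          ∑ i ∈ σ, r i * (cs j * φs j (A i)) := by
        intro j hj
        rw [(hφ j (Finset.mem_range.1 hj)).1.2.eq_sum hσ r hr, Finset.mul_sum]
        exact Finset.sum_congr rfl fun i _ => by ring
      rw [Finset.sum_congr rfl h1, Finset.sum_comm, ← Finset.sum_add_distrib]
      refine Finset.sum_congr rfl fun i hi => ?_
      have him := hlt σ hσ i hi
      rw [map_smul, hM i (by omega), hφ₀val i him, ← Finset.mul_sum, smul_eq_mul]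
      simp only [him, if_true]
      ring
    constructor
    · intro x y t ht0 ht1
      have h1 : ∑ j ∈ Finset.range p, cs j * φs j (t • x + (1 - t) • y) ≤
          ∑ j ∈ Finset.range p, (t * (cs j * φs j x) + (1 - t) * (cs j * φs j y)) := by
        refine Finset.sum_le_sum fun j hj => ?_
        have hj' := Finset.mem_range.1 hj
        have := mul_le_mul_of_nonneg_left ((hφ j hj').2 x y t ht0 ht1) (hcs j hj')
        linarith
      rw [Finset.sum_add_distrib, ← Finset.mul_sum, ← Finset.mul_sum] at h1
      rw [key, key x, key y, map_add, map_smul, map_smul, smul_eq_mul, smul_eq_mul]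
      linarith
    · intro k hk
      rw [key, hM (m + k) (by omega)]
      have := hμ k hk
      simp
      linarith
  · rintro ⟨hconv, hle⟩
    obtain ⟨N, hN, hint⟩ := exists_integral_multiple hφ₀lin hcomp
    have hN' : (0 : ℚ) < N := by exact_mod_cast hN
    refine ⟨1, fun _ x => N * φ₀ x, fun _ => (N : ℚ)⁻¹, fun k => 1 - φ₀ (A (m + k)),
      fun _ _ => ⟨⟨hint, ?_⟩, ?_⟩, fun _ _ => by positivity,
      fun k hk => by have := hle k hk; linarith, ?_⟩
    · intro σ hσ
      obtain ⟨L, hL⟩ := hφ₀lin σ hσ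
      exact ⟨(N : ℚ) • L, fun x hx => by simp [hL x hx]⟩
    · intro x y t ht0 ht1
      have := mul_le_mul_of_nonneg_left (hconv x y t ht0 ht1) hN'.le
      dsimp only
      linarith
    · intro l _
      simp only [Finset.sum_range_one, mul_assoc]
      rw [← Finset.mul_sum, inv_mul_cancel_left₀ hN'.ne', Finset.sum_range_add,
        Finset.sum_range_add, add_assoc, ← Finset.sum_add_distrib]
      congr 1
      · refine Finset.sum_congr rfl fun i hi => ?_
        rw [hφ₀val i (Finset.mem_range.1 hi), one_mul]
      · exact Finset.sum_congr rfl fun k _ => by ring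
end

section
/- (Boundary description used in the crepant resolution lemma of Section 7.) Let Σ be a complete simplicial fan on a_1, …, a_m ∈ ℝ^d and let φ₀ : ℝ^d → ℝ be a function that is linear on each cone of Σ with φ₀(a_i) = 1 for all i = 1, …, m. If φ₀ is convex, then the topological boundary of the convex hull conv({a_1, …, a_m}) in ℝ^d equals the union ∪_{σ∈Σ} conv({a_i : i ∈ σ}). -/
open Finset

/-- The cone spanned by the vectors `A i`, `i ∈ σ`, in `ℝ^d`. -/
def coneR {d : ℕ} (A : ℕ → (Fin d → ℝ)) (σ : Finset ℕ) : Set (Fin d → ℝ) :=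
  {x | ∃ r : ℕ → ℝ, (∀ i, 0 ≤ r i) ∧ x = ∑ i ∈ σ, r i • A i}

/-- A complete simplicial fan on `A 0, …, A (m-1)` in `ℝ^d`: a nonempty finite
collection of subsets of `{0,…,m-1}`, closed under taking subsets, satisfying
(i) linear independence, (ii) completeness and (iii) the intersection axiom. -/
def IsFanR {d : ℕ} (A : ℕ → (Fin d → ℝ)) (m : ℕ) (S : Finset (Finset ℕ)) : Prop :=
  S.Nonempty ∧
  (∀ σ ∈ S, ∀ i ∈ σ, i < m) ∧
  (∀ σ ∈ S, ∀ τ ⊆ σ, τ ∈ S) ∧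
  (∀ σ ∈ S, LinearIndependent ℝ (fun i : ↥σ => A i.1)) ∧
  (∀ x : Fin d → ℝ, ∃ σ ∈ S, x ∈ coneR A σ) ∧
  (∀ σ ∈ S, ∀ σ' ∈ S, ∃ τ ∈ S, τ ⊆ σ ∩ σ' ∧ coneR A σ ∩ coneR A σ' = coneR A τ)

/-- `φ` is linear on each cone of the fan `S`. -/
def PwLinR {d : ℕ} (A : ℕ → (Fin d → ℝ)) (S : Finset (Finset ℕ)) (φ : (Fin d → ℝ) → ℝ) : Prop :=
  ∀ σ ∈ S, ∃ L : (Fin d → ℝ) →ₗ[ℝ] ℝ, ∀ x ∈ coneR A σ, φ x = L x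

/-- Convexity for functions `ℝ^d → ℝ`. -/
def ConvexFnR {d : ℕ} (φ : (Fin d → ℝ) → ℝ) : Prop :=
  ∀ x y : Fin d → ℝ, ∀ t : ℝ, 0 ≤ t → t ≤ 1 →
    φ (t • x + (1 - t) • y) ≤ t * φ x + (1 - t) * φ y

/-- (Boundary description used in Section 7.) If the piecewise
linear function `φ₀` with `φ₀ (a i) = 1` for all rays is convex, then the
topological boundary of `conv{a_1, …, a_m}` equals `⋃_{σ ∈ Σ} conv{a_i : i ∈ σ}`. -/
theorem frontier_convexHull_eq_union (d m : ℕ) (hd : 1 ≤ d) (hm : 1 ≤ m)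
    (A : ℕ → (Fin d → ℝ)) (S : Finset (Finset ℕ)) (hfan : IsFanR A m S)
    (φ₀ : (Fin d → ℝ) → ℝ) (hlin : PwLinR A S φ₀)
    (hval : ∀ i < m, φ₀ (A i) = 1) (hconv : ConvexFnR φ₀) :
    frontier (convexHull ℝ (A '' {i | i < m})) =
      ⋃ σ ∈ S, convexHull ℝ (A '' ↑σ) := by
  obtain ⟨-, hlt, -, -, hcov, -⟩ := hfan
  have hAc : ∀ (σ : Finset ℕ), ∀ i ∈ σ, A i ∈ coneR A σ := by
    intro σ i hi
    refine ⟨fun j => if j = i then 1 else 0, fun j => ?_, ?_⟩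
    · dsimp only; split_ifs <;> norm_num
    · simp [ite_smul, Finset.sum_ite_eq', hi]
  have hform : ∀ σ ∈ S, ∀ r : ℕ → ℝ, (∀ i, 0 ≤ r i) →
      φ₀ (∑ i ∈ σ, r i • A i) = ∑ i ∈ σ, r i := by
    intro σ hσ r hr
    obtain ⟨L, hL⟩ := hlin σ hσ
    rw [hL _ ⟨r, hr, rfl⟩, map_sum]
    refine Finset.sum_congr rfl fun i hi => ?_
    rw [map_smul, ← hL _ (hAc σ i hi), hval i (hlt σ hσ i hi), smul_eq_mul, mul_one]
  have hhom : ∀ (t : ℝ) (x : Fin d → ℝ), 0 ≤ t → φ₀ (t • x) = t * φ₀ x := by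
    intro t x ht
    obtain ⟨σ, hσ, r, hr, rfl⟩ := hcov x
    rw [Finset.smul_sum, hform σ hσ r hr]
    simp_rw [smul_smul]
    rw [hform σ hσ (fun i => t * r i) (fun i => mul_nonneg ht (hr i)), Finset.mul_sum]
  have hcx : ConvexOn ℝ Set.univ φ₀ := by
    refine ⟨convex_univ, fun x _ y _ a b ha hb hab => ?_⟩
    have h := hconv x y a ha (by linarith)
    have hb' : 1 - a = b := by linarith
    rw [hb'] at h
    simpa [smul_eq_mul] using h
  have hcont : Continuous φ₀ := by
    rw [← continuousOn_univ]
    exact hcx.continuousOn isOpen_univ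
  have hmem : ∀ i < m, A i ∈ convexHull ℝ (A '' {i | i < m}) := fun i hi =>
    subset_convexHull ℝ _ ⟨i, hi, rfl⟩
  have hPc := convex_convexHull ℝ (A '' {i | i < m})
  -- normalised combinations
  have hcomb : ∀ σ ∈ S, ∀ r : ℕ → ℝ, (∀ i, 0 ≤ r i) → ∑ i ∈ σ, r i = 1 →
      ∑ i ∈ σ, r i • A i ∈ convexHull ℝ (A '' (σ : Set ℕ)) := by
    intro σ _ r hr h1
    exact (convex_convexHull ℝ _).sum_mem (fun i _ => hr i) h1
      (fun i hi => subset_convexHull ℝ _ ⟨i, hi, rfl⟩)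
  have hsub : ∀ σ ∈ S, convexHull ℝ (A '' (σ : Set ℕ)) ⊆
      convexHull ℝ (A '' {i | i < m}) := fun σ hσ =>
    convexHull_mono (Set.image_mono fun i hi => hlt σ hσ i hi)
  have hone : ∀ x, φ₀ x = 1 → ∃ σ ∈ S, x ∈ convexHull ℝ (A '' (σ : Set ℕ)) := by
    intro x hx
    obtain ⟨σ, hσ, r, hr, rfl⟩ := hcov x
    rw [hform σ hσ r hr] at hx
    exact ⟨σ, hσ, hcomb σ hσ r hr hx⟩
  have hnn : ∀ x, 0 ≤ φ₀ x := by
    intro x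
    obtain ⟨σ, hσ, r, hr, rfl⟩ := hcov x
    rw [hform σ hσ r hr]
    exact Finset.sum_nonneg fun i _ => hr i
  have hpos : ∀ x, 0 < φ₀ x → (φ₀ x)⁻¹ • x ∈ convexHull ℝ (A '' {i | i < m}) := by
    intro x hx
    obtain ⟨σ, hσ, h⟩ := hone ((φ₀ x)⁻¹ • x) (by
      rw [hhom _ _ (inv_nonneg.2 hx.le), inv_mul_cancel₀ hx.ne'])
    exact hsub σ hσ h
  have hz : ∀ x, φ₀ x = 0 → x = 0 := by
    intro x hx
    obtain ⟨σ, hσ, r, hr, rfl⟩ := hcov x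
    rw [hform σ hσ r hr, Finset.sum_eq_zero_iff_of_nonneg (fun i _ => hr i)] at hx
    exact Finset.sum_eq_zero fun i hi => by rw [hx i hi, zero_smul]
  have h0 : (0 : Fin d → ℝ) ∈ convexHull ℝ (A '' {i | i < m}) := by
    have hA0 := hmem 0 hm
    rcases (hnn (-A 0)).eq_or_lt with h | h
    · have := hz _ h.symm
      rw [neg_eq_zero] at this
      rwa [this] at hA0
    · have h2 := hpos _ h
      set c := φ₀ (-A 0) with hc
      have h3 := hPc hA0 h2 (a := 1 / (1 + c)) (b := c / (1 + c))
        (by positivity) (by positivity) (by field_simp)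
      convert h3 using 1
      rw [smul_neg, smul_neg, smul_smul, ← sub_eq_add_neg, ← sub_smul]
      have : 1 / (1 + c) - c / (1 + c) * c⁻¹ = 0 := by field_simp; ring
      rw [this, zero_smul]
  have hP : convexHull ℝ (A '' {i | i < m}) = {x | φ₀ x ≤ 1} := by
    apply Set.Subset.antisymm
    · refine convexHull_min ?_ ?_
      · rintro _ ⟨i, hi, rfl⟩
        exact (hval i hi).le
      · simpa using hcx.convex_le 1
    · intro x hx
      rcases (hnn x).eq_or_lt with h | h
      · rw [hz _ h.symm]; exact h0
      · have h3 := hPc (hpos x h) h0 (a := φ₀ x) (b := 1 - φ₀ x) h.le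
          (sub_nonneg.2 hx) (by ring)
        rwa [smul_zero, add_zero, smul_smul, mul_inv_cancel₀ h.ne', one_smul] at h3
  have hcl : IsClosed {x | φ₀ x ≤ 1} := isClosed_le hcont continuous_const
  rw [hP, hcl.frontier_eq]
  ext x
  simp only [Set.mem_diff, Set.mem_setOf_eq, Set.mem_iUnion, exists_prop]
  constructor
  · rintro ⟨hx, hni⟩
    refine hone x (hx.antisymm (not_lt.1 fun h => hni ?_))
    have ho : IsOpen {x | φ₀ x < 1} := isOpen_lt hcont continuous_const
    exact interior_maximal (fun y (hy : φ₀ y < 1) => hy.le) ho h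
  · rintro ⟨σ, hσ, hx⟩
    have hx1 : φ₀ x = 1 := by
      obtain ⟨L, hL⟩ := hlin σ hσ
      have hs : convexHull ℝ (A '' (σ : Set ℕ)) ⊆ {y | y ∈ coneR A σ ∧ L y = 1} := by
        refine convexHull_min ?_ ?_
        · rintro _ ⟨i, hi, rfl⟩
          exact ⟨hAc σ i hi, by rw [← hL _ (hAc σ i hi), hval i (hlt σ hσ i hi)]⟩
        · rintro _ ⟨⟨r, hr, rfl⟩, h1⟩ _ ⟨⟨s, hs, rfl⟩, h2⟩ a b ha hb hab
          refine ⟨⟨fun i => a * r i + b * s i, fun i =>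
            add_nonneg (mul_nonneg ha (hr i)) (mul_nonneg hb (hs i)), ?_⟩, ?_⟩
          · simp_rw [Finset.smul_sum, add_smul, Finset.sum_add_distrib, smul_smul]
          · rw [map_add, map_smul, map_smul, h1, h2]
            simpa using hab
      rw [hL x (hs hx).1, (hs hx).2]
    refine ⟨hx1.le, fun hi => ?_⟩
    have hct : Filter.Tendsto (fun t : ℝ => t • x) (nhds 1) (nhds x) := by
      have : Continuous fun t : ℝ => t • x := by fun_prop
      simpa using this.tendsto 1
    have hev := (hct.eventually (mem_interior_iff_mem_nhds.1 hi)).filter_mono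
      (nhdsWithin_le_nhds (s := Set.Ioi (1 : ℝ)))
    obtain ⟨t, ht, ht1⟩ := (hev.and self_mem_nhdsWithin).exists
    have ht1 : 1 < t := ht1
    have ht : φ₀ (t • x) ≤ 1 := ht
    rw [hhom t x (by linarith), hx1] at ht
    linarith
end

section
/- (Combinatorial form of the lemma: a toric resolution is crepant iff the new ray generators lie on the boundary of conv(a_1,…,a_m).) Let Σ be a complete simplicial fan on a_1, …, a_m ∈ ℝ^d and let φ₀ : ℝ^d → ℝ be linear on each cone of Σ with φ₀(a_i) = 1 for all i; assume φ₀ is convex. Let σ ∈ Σ and let κ_i ≥ 0 (i ∈ σ) be real numbers, not all zero, and set x := Σ_{i∈σ} κ_i a_i. Then x belongs to the topological boundary of conv({a_1, …, a_m}) if and only if Σ_{i∈σ} κ_i = 1. -/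
open Finset

theorem phi_cone_aux {d m : ℕ} {A : ℕ → (Fin d → ℝ)} {S : Finset (Finset ℕ)}
    (hfan : IsFanR A m S) {φ₀ : (Fin d → ℝ) → ℝ} (hlin : PwLinR A S φ₀)
    (hval : ∀ i < m, φ₀ (A i) = 1) {τ : Finset ℕ} (hτ : τ ∈ S) (r : ℕ → ℝ) (hr : ∀ i, 0 ≤ r i) :
    φ₀ (∑ i ∈ τ, r i • A i) = ∑ i ∈ τ, r i := by
  obtain ⟨L, hL⟩ := hlin τ hτ
  rw [hL _ ⟨r, hr, rfl⟩, map_sum]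
  refine Finset.sum_congr rfl fun i hi => ?_
  have h1 : L (A i) = 1 := by
    rw [← hL (A i) ⟨fun j => if j = i then 1 else 0, fun j => by dsimp only; split_ifs <;> norm_num, ?_⟩]
    · exact hval i (hfan.2.1 τ hτ i hi)
    · simp [hi]
  rw [map_smul, h1, smul_eq_mul, mul_one]

theorem zero_mem_hull_aux {d m : ℕ} (hm : 1 ≤ m) {A : ℕ → (Fin d → ℝ)} {S : Finset (Finset ℕ)}
    (hfan : IsFanR A m S) : (0 : Fin d → ℝ) ∈ convexHull ℝ (A '' {i | i < m}) := by
  obtain ⟨τ, hτ, r, hr, h⟩ := hfan.2.2.2.2.1 (-A 0)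
  have hc := convex_convexHull ℝ (A '' {i | i < m})
  have hmem : ∀ i < m, A i ∈ convexHull ℝ (A '' {i | i < m}) := fun i hi =>
    subset_convexHull ℝ _ ⟨i, hi, rfl⟩
  have h0 := hmem 0 (by omega)
  by_cases hs : ∑ i ∈ τ, r i = 0
  · have hz := (Finset.sum_eq_zero_iff_of_nonneg (fun i _ => hr i)).1 hs
    have : -A 0 = 0 := by
      rw [h]
      exact Finset.sum_eq_zero fun i hi => by rw [hz i hi, zero_smul]
    rw [neg_eq_zero] at this
    rwa [this] at h0
  · have hpos : 0 < ∑ i ∈ τ, r i := lt_of_le_of_ne (Finset.sum_nonneg fun i _ => hr i) (Ne.symm hs)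
    have hcm := hc.centerMass_mem (t := τ) (w := r) (z := A) (fun i _ => hr i) hpos
      (fun i hi => hmem i (hfan.2.1 τ hτ i hi))
    rw [Finset.centerMass, ← h] at hcm
    set c := ∑ i ∈ τ, r i
    have := hc h0 hcm (a := 1 / (1 + c)) (b := c / (1 + c)) (by positivity) (by positivity)
      (by field_simp)
    convert this using 1
    rw [smul_smul, smul_neg, show c / (1 + c) * c⁻¹ = 1 / (1 + c) by field_simp]
    simp

theorem hull_eq_aux {d m : ℕ} (hm : 1 ≤ m) {A : ℕ → (Fin d → ℝ)} {S : Finset (Finset ℕ)}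
    (hfan : IsFanR A m S) {φ₀ : (Fin d → ℝ) → ℝ} (hlin : PwLinR A S φ₀)
    (hval : ∀ i < m, φ₀ (A i) = 1) (hconv : ConvexOn ℝ Set.univ φ₀) :
    convexHull ℝ (A '' {i | i < m}) = {x | φ₀ x ≤ 1} := by
  apply Set.Subset.antisymm
  · refine convexHull_min ?_ ?_
    · rintro _ ⟨i, hi, rfl⟩
      exact (hval i hi).le
    · simpa using hconv.convex_le 1
  · intro y hy
    obtain ⟨τ, hτ, r, hr, rfl⟩ := hfan.2.2.2.2.1 y
    rw [Set.mem_setOf_eq, phi_cone_aux hfan hlin hval hτ r hr] at hy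
    have hc := convex_convexHull ℝ (A '' {i | i < m})
    have hz := zero_mem_hull_aux hm hfan
    by_cases hs : ∑ i ∈ τ, r i = 0
    · have hz' := (Finset.sum_eq_zero_iff_of_nonneg (fun i _ => hr i)).1 hs
      rwa [Finset.sum_eq_zero fun i hi => by rw [hz' i hi, zero_smul]]
    · have hpos : 0 < ∑ i ∈ τ, r i :=
        lt_of_le_of_ne (Finset.sum_nonneg fun i _ => hr i) (Ne.symm hs)
      have hcm := hc.centerMass_mem (t := τ) (w := r) (z := A) (fun i _ => hr i) hpos
        (fun i hi => subset_convexHull ℝ _ ⟨i, hfan.2.1 τ hτ i hi, rfl⟩)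
      have := hc.smul_mem_of_zero_mem hz hcm ⟨hpos.le, hy⟩
      rwa [Finset.centerMass, smul_smul, mul_inv_cancel₀ hs, one_smul] at this

/-- (Crepancy criterion: a point of a cone lies on the boundary of
`conv{a_1,…,a_m}` iff its coefficient sum is `1`.) -/
theorem mem_frontier_iff_coeff_sum_eq_one (d m : ℕ) (hd : 1 ≤ d) (hm : 1 ≤ m)
    (A : ℕ → (Fin d → ℝ)) (S : Finset (Finset ℕ)) (hfan : IsFanR A m S)
    (φ₀ : (Fin d → ℝ) → ℝ) (hlin : PwLinR A S φ₀)
    (hval : ∀ i < m, φ₀ (A i) = 1) (hconv : ConvexFnR φ₀)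
    (σ : Finset ℕ) (hσ : σ ∈ S) (κ : ℕ → ℝ) (hκ0 : ∀ i, 0 ≤ κ i)
    (hκne : ∃ i ∈ σ, κ i ≠ 0) :
    (∑ i ∈ σ, κ i • A i) ∈ frontier (convexHull ℝ (A '' {i | i < m})) ↔
      ∑ i ∈ σ, κ i = 1 := by
  have hcv : ConvexOn ℝ Set.univ φ₀ := by
    refine ⟨convex_univ, fun x _ y _ a b ha hb hab => ?_⟩
    obtain rfl : b = 1 - a := by linarith
    exact hconv x y a ha (by linarith)
  have hcont : Continuous φ₀ := by
    rw [← continuousOn_univ]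
    exact hcv.continuousOn isOpen_univ
  rw [hull_eq_aux hm hfan hlin hval hcv, ← phi_cone_aux hfan hlin hval hσ κ hκ0]
  constructor
  · intro h
    exact frontier_le_subset_eq hcont continuous_const h
  · intro h
    refine ⟨subset_closure h.le, fun hint => ?_⟩
    set x := ∑ i ∈ σ, κ i • A i with hx
    have ht : Filter.Tendsto (fun t : ℝ => t • x) (nhdsWithin 1 (Set.Ioi 1)) (nhds x) := by
      have : Continuous (fun t : ℝ => t • x) := by fun_prop
      have h2 := this.tendsto 1
      rw [one_smul] at h2
      exact h2.mono_left nhdsWithin_le_nhds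
    have hev := ht.eventually (mem_interior_iff_mem_nhds.1 hint)
    obtain ⟨t, ht1, ht2⟩ := (hev.and self_mem_nhdsWithin).exists
    have ht2 : 1 < t := ht2
    have ht1 : φ₀ (t • x) ≤ 1 := ht1
    have h3 := phi_cone_aux hfan hlin hval hσ (fun i => t * κ i)
      (fun i => mul_nonneg (by linarith) (hκ0 i))
    simp only [mul_smul] at h3
    rw [← Finset.smul_sum, ← Finset.mul_sum, ← phi_cone_aux hfan hlin hval hσ κ hκ0, ← hx, h] at h3
    linarith
end

section
/- (Inequality (4.13) from the proof of the coherence theorem: convex classes are nonnegative on primitive relations.) Let φ : ℚ^d → ℚ be convex and linear on each cone of Σ. Let I ⊆ {1, …, n} and let l ∈ ℚ^n with l_i ≥ 0 for all i; suppose there is σ ∈ Σ such that l_i = 0 whenever a_i ∉ cone(σ), and suppose Σ_{i∈I} a_i = Σ_{i=1}^n l_i a_i. Then Σ_{i∈I} φ(a_i) ≥ Σ_{i=1}^n l_i φ(a_i). -/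
open Finset

/-- (Inequality (4.13): convex classes are nonnegative on primitive
relations.) If `φ` is convex and linear on each cone of `Σ`, `l` has nonnegative
entries supported (among the indices `< n`) on `{i : a_i ∈ cone(σ)}` for some
`σ ∈ Σ`, and `∑_{i ∈ I} a_i = ∑_i l_i a_i`, then
`∑_{i ∈ I} φ(a_i) ≥ ∑_i l_i φ(a_i)`. -/
theorem convex_nonneg_on_primitive_relation (d m e : ℕ) (hd : 1 ≤ d) (hm : 1 ≤ m)
    (a : ℕ → (Fin d → ℤ)) (A : ℕ → (Fin d → ℚ)) (hA : ∀ i j, A i j = (a i j : ℚ))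
    (S : Finset (Finset ℕ)) (hfan : IsFanQ A m S)
    (φ : (Fin d → ℚ) → ℚ) (hφconv : ConvexFnQ φ) (hφlin : PwLinQ A S φ)
    (I : Finset ℕ) (hI : ∀ i ∈ I, i < m + e)
    (l : ℕ → ℚ) (hl0 : ∀ i, 0 ≤ l i)
    (hsupp : ∃ σ ∈ S, ∀ i < m + e, A i ∉ coneQ A σ → l i = 0)
    (heq : ∑ i ∈ I, A i = ∑ i ∈ Finset.range (m + e), l i • A i) :
    ∑ i ∈ Finset.range (m + e), l i * φ (A i) ≤ ∑ i ∈ I, φ (A i) := by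
  obtain ⟨-, -, -, -, hcomp, -⟩ := hfan
  have hsmul : ∀ (σ : Finset ℕ) (t : ℚ) (x : Fin d → ℚ), 0 ≤ t → x ∈ coneQ A σ →
      t • x ∈ coneQ A σ := by
    rintro σ t x ht ⟨r, hr, rfl⟩
    exact ⟨fun i => t * r i, fun i => mul_nonneg ht (hr i), by
      simp only [Finset.smul_sum, mul_smul]⟩
  have hadd : ∀ (σ : Finset ℕ) (x y : Fin d → ℚ), x ∈ coneQ A σ → y ∈ coneQ A σ →
      x + y ∈ coneQ A σ := by
    rintro σ x y ⟨r, hr, rfl⟩ ⟨s, hs, rfl⟩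
    exact ⟨fun i => r i + s i, fun i => add_nonneg (hr i) (hs i), by
      simp only [add_smul, Finset.sum_add_distrib]⟩
  have hzero : ∀ σ : Finset ℕ, (0 : Fin d → ℚ) ∈ coneQ A σ := fun σ =>
    ⟨fun _ => 0, fun _ => le_rfl, by simp⟩
  have hhom : ∀ (t : ℚ) (x : Fin d → ℚ), 0 ≤ t → φ (t • x) = t * φ x := by
    intro t x ht
    obtain ⟨σ, hσ, hx⟩ := hcomp x
    obtain ⟨L, hL⟩ := hφlin σ hσ
    rw [hL _ (hsmul σ t x ht hx), hL _ hx, map_smul, smul_eq_mul]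
  have hsub : ∀ x y : Fin d → ℚ, φ (x + y) ≤ φ x + φ y := by
    intro x y
    have h := hφconv x y (1 / 2) (by norm_num) (by norm_num)
    have e1 : (1 / 2 : ℚ) • x + (1 - 1 / 2 : ℚ) • y = (1 / 2 : ℚ) • (x + y) := by
      rw [smul_add]; norm_num
    rw [e1, hhom _ _ (by norm_num)] at h
    linarith
  have h0 : φ 0 = 0 := by
    have h := hhom 0 0 le_rfl
    simpa using h
  have hsum : ∀ J : Finset ℕ, φ (∑ i ∈ J, A i) ≤ ∑ i ∈ J, φ (A i) := by
    intro J
    induction J using Finset.induction_on with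
    | empty => simp [h0]
    | insert j J hj ih =>
      rw [Finset.sum_insert hj, Finset.sum_insert hj]
      linarith [hsub (A j) (∑ i ∈ J, A i)]
  obtain ⟨σ, hσ, hs⟩ := hsupp
  obtain ⟨L, hL⟩ := hφlin σ hσ
  have hmem : ∑ i ∈ Finset.range (m + e), l i • A i ∈ coneQ A σ := by
    refine Finset.sum_induction _ (· ∈ coneQ A σ) (hadd σ) (hzero σ) ?_
    intro i hi
    by_cases h : A i ∈ coneQ A σ
    · exact hsmul σ _ _ (hl0 i) h
    · rw [hs i (Finset.mem_range.mp hi) h, zero_smul]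
      exact hzero σ
  have hval : φ (∑ i ∈ Finset.range (m + e), l i • A i)
      = ∑ i ∈ Finset.range (m + e), l i * φ (A i) := by
    rw [hL _ hmem, map_sum]
    refine Finset.sum_congr rfl fun i hi => ?_
    rw [map_smul, smul_eq_mul]
    by_cases h : A i ∈ coneQ A σ
    · rw [hL _ h]
    · rw [hs i (Finset.mem_range.mp hi) h, zero_mul, zero_mul]
  rw [← hval, ← heq]
  exact hsum I
end
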